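/- arXiv:1708.02552 — 2 statements merged into one kernel-verified Lean document; each statement's English description precedes it below -/
import Mathlib

section
/- Let n ≥ 1, let H ∈ ℝ^{n×n} be symmetric positive definite, let s ∈ ℝⁿ be nonzero, and let v ∈ ℝⁿ satisfy sᵀv > 0. Then the BFGS Hessian update H₊ := (I − s sᵀ H/(sᵀ H s))ᵀ H (I − s sᵀ H/(sᵀ H s)) + v vᵀ/(sᵀ v) satisfies det(H₊) = det(H) · (sᵀ v)/(sᵀ H s). -/
open Matrix

/-- The BFGS Hessian update
`H₊ = (I − s sᵀ H/(sᵀ H s))ᵀ H (I − s sᵀ H/(sᵀ H s)) + v vᵀ/(sᵀ v)`. -/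
noncomputable def bfgsH {n : ℕ} (H : Matrix (Fin n) (Fin n) ℝ) (s v : Fin n → ℝ) :
    Matrix (Fin n) (Fin n) ℝ :=
  (1 - (s ⬝ᵥ H.mulVec s)⁻¹ • (vecMulVec s s * H))ᵀ * H *
    (1 - (s ⬝ᵥ H.mulVec s)⁻¹ • (vecMulVec s s * H)) +
  (s ⬝ᵥ v)⁻¹ • vecMulVec v v

/-- The determinant of a rank-two perturbation of the identity. -/
theorem det_one_add_vecMulVec_add_vecMulVec {m R : Type*} [Fintype m] [DecidableEq m] [CommRing R]
    (u p w q : m → R) :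
    (1 + (vecMulVec u p + vecMulVec w q)).det =
      (1 + p ⬝ᵥ u) * (1 + q ⬝ᵥ w) - (p ⬝ᵥ w) * (q ⬝ᵥ u) := by
  have h : vecMulVec u p + vecMulVec w q =
      (of ![u, w] : Matrix (Fin 2) m R)ᵀ * (of ![p, q] : Matrix (Fin 2) m R) := by
    ext i j
    simp [mul_apply, Fin.sum_univ_two, vecMulVec_apply]
  rw [h, det_one_add_mul_comm, det_fin_two]
  simp [vecMul_transpose, dotProduct, mul_comm]

/-- For symmetric `H`, the BFGS update is the rank-two correction
`H - (H s)(H s)ᵀ / (sᵀ H s) + v vᵀ / (sᵀ v)`. -/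
theorem bfgsH_eq_add {n : ℕ} {H : Matrix (Fin n) (Fin n) ℝ} (hH : Hᵀ = H) (s v : Fin n → ℝ)
    (ha : s ⬝ᵥ H *ᵥ s ≠ 0) :
    bfgsH H s v = H + (-(s ⬝ᵥ H *ᵥ s)⁻¹ • vecMulVec (H *ᵥ s) (H *ᵥ s) +
      (s ⬝ᵥ v)⁻¹ • vecMulVec v v) := by
  have hs : s ᵥ* H = H *ᵥ s := by rw [← mulVec_transpose, hH]
  have hs' : (H *ᵥ s) ⬝ᵥ s = s ⬝ᵥ H *ᵥ s := dotProduct_comm _ _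
  simp only [bfgsH, vecMulVec_mul, hs, transpose_sub, transpose_one, transpose_smul,
    transpose_vecMulVec, sub_mul, mul_sub, one_mul, mul_one, smul_mul_assoc, mul_smul_comm,
    mul_vecMulVec, vecMulVec_mulVec, hs']
  ext i j
  simp [vecMulVec_apply]
  field_simp
  ring

theorem bfgs_det_update (n : ℕ) (hn : 1 ≤ n)
    (H : Matrix (Fin n) (Fin n) ℝ) (hH : H.PosDef)
    (s v : Fin n → ℝ) (hs : s ≠ 0) (hsv : 0 < s ⬝ᵥ v) :
    (bfgsH H s v).det = H.det * ((s ⬝ᵥ v) / (s ⬝ᵥ H.mulVec s)) := by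
  have ha : s ⬝ᵥ H *ᵥ s ≠ 0 := by simpa using (hH.dotProduct_mulVec_pos hs).ne'
  have hT : Hᵀ = H := by simpa [IsHermitian] using hH.isHermitian
  have hw : H *ᵥ (H⁻¹ *ᵥ v) = v := by
    rw [mulVec_mulVec, mul_nonsing_inv _ hH.det_pos.ne'.isUnit, one_mulVec]
  have hy : (H *ᵥ s) ⬝ᵥ (H⁻¹ *ᵥ v) = s ⬝ᵥ v := by
    rw [← vecMul_transpose, hT, ← dotProduct_mulVec, hw]
  have hf : bfgsH H s v = H * (1 + (vecMulVec s (-(s ⬝ᵥ H *ᵥ s)⁻¹ • (H *ᵥ s)) +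
      vecMulVec (H⁻¹ *ᵥ v) ((s ⬝ᵥ v)⁻¹ • v))) := by
    rw [bfgsH_eq_add hT s v ha, mul_add, mul_add, mul_vecMulVec, mul_vecMulVec, hw, mul_one,
      vecMulVec_smul, vecMulVec_smul]
  rw [hf, det_mul, det_one_add_vecMulVec_add_vecMulVec]
  simp only [smul_dotProduct, hy, dotProduct_comm (H *ᵥ s) s, dotProduct_comm v s, smul_eq_mul]
  have hb := hsv.ne'
  field_simp
  ring
end

section
/- Let n ≥ 1, let f : ℝⁿ → ℝ be convex, let H ∈ ℝ^{n×n} be symmetric positive definite, let α ∈ (0,1), let X ⊆ ℝⁿ be nonempty, compact, and convex with x_k in its interior, and suppose x_k is not a global minimizer of f. Let {x_m}_{m≥1} ⊆ X with x_1 = x_k, and for each m let g_m ∈ ℝⁿ be a subgradient of f at x_m (i.e., f(y) ≥ f(x_m) + g_mᵀ(y − x_m) for all y ∈ ℝⁿ), define l_m(x) := max_{j∈{1,…,m}} [f(x_j) + g_jᵀ(x − x_j)], and suppose x_{m+1} minimizes q_m(x) := l_m(x) + (1/2)(x − x_k)ᵀH(x − x_k) over X. Then there exists m ∈ ℕ such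 that f(x_k) − f(x_{m+1}) ≥ α·(f(x_k) − l_m(x_{m+1})). -/
open Matrix

/-- For a subgradient `g` of `f` at `a`, the linearization error at `b` is bounded by a second
difference of `f`. -/
theorem linearization_error_le_second_difference {ι : Type*} [Fintype ι] {f : (ι → ℝ) → ℝ}
    {a g : ι → ℝ} (hg : ∀ y, f y ≥ f a + g ⬝ᵥ (y - a)) (b : ι → ℝ) :
    f b - (f a + g ⬝ᵥ (b - a)) ≤ f b - 2 * f a + f (a + (a - b)) := by
  have h := hg (a + (a - b))
  rw [add_sub_cancel_left, ← neg_sub b a, dotProduct_neg, neg_sub] at h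
  linarith

/-- In a compact set, the second differences of a continuous function along a sequence cannot
stay bounded away from zero. -/
theorem exists_second_difference_le {E : Type*} [NormedAddCommGroup E] {f : E → ℝ}
    (hf : Continuous f) {X : Set E} (hX : IsCompact X) {x : ℕ → E} (hx : ∀ m, x m ∈ X)
    {ε : ℝ} (hε : 0 < ε) :
    ∃ i j, i < j ∧ f (x j) - 2 * f (x i) + f (x i + (x i - x j)) ≤ ε := by
  obtain ⟨a, -, φ, hφ, ha⟩ := hX.tendsto_subseq hx
  have hi : Filter.Tendsto (fun k => x (φ k)) Filter.atTop (nhds a) := ha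
  have hj : Filter.Tendsto (fun k => x (φ (k + 1))) Filter.atTop (nhds a) :=
    hi.comp (Filter.tendsto_add_atTop_nat 1)
  have hlim := (((hf.tendsto a).comp hj).sub (((hf.tendsto a).comp hi).const_mul 2)).add
    ((hf.tendsto _).comp (hi.add (hi.sub hj)))
  have hzero : f a - 2 * f a + f (a + (a - a)) = 0 := by
    rw [sub_self, add_zero]; ring
  rw [hzero] at hlim
  obtain ⟨k, hk⟩ := (hlim.eventually (gt_mem_nhds hε)).exists
  exact ⟨φ k, φ (k + 1), hφ k.lt_succ_self, hk.le⟩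

/-- If `a` is interior to `X` and does not minimize the convex function `f`, then adding a
quadratic term centred at `a` still leaves a point of `X` with value below `f a`. -/
theorem exists_add_quadratic_lt {ι : Type*} [Fintype ι] {f : (ι → ℝ) → ℝ}
    (hf : ConvexOn ℝ Set.univ f) (H : Matrix ι ι ℝ) {X : Set (ι → ℝ)} {a y : ι → ℝ}
    (ha : a ∈ interior X) (hy : f y < f a) :
    ∃ z ∈ X, f z + (1/2) * ((z - a) ⬝ᵥ H.mulVec (z - a)) < f a := by
  set Q := (y - a) ⬝ᵥ H.mulVec (y - a) with hQ
  have hX : ∀ᶠ t : ℝ in nhds 0, a + t • (y - a) ∈ X := by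
    have hc : Continuous fun t : ℝ => a + t • (y - a) := by fun_prop
    have h := hc.tendsto 0
    simp only [zero_smul, add_zero] at h
    exact h (mem_interior_iff_mem_nhds.mp ha)
  have hq : ∀ᶠ t : ℝ in nhds 0, t * Q / 2 < f a - f y := by
    have hc : Continuous fun t : ℝ => t * Q / 2 := by fun_prop
    have h := hc.tendsto 0
    simp only [zero_mul, zero_div] at h
    exact h.eventually (gt_mem_nhds (sub_pos.mpr hy))
  have h1 : ∀ᶠ t : ℝ in nhds 0, t < 1 := gt_mem_nhds one_pos
  obtain ⟨t, ⟨⟨htX, htq⟩, ht1⟩, ht0⟩ :=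
    ((((hX.and hq).and h1).filter_mono nhdsWithin_le_nhds).and
      (self_mem_nhdsWithin (s := Set.Ioi (0 : ℝ)))).exists
  have ht0 : 0 < t := ht0
  refine ⟨_, htX, ?_⟩
  have hconv : f (a + t • (y - a)) ≤ (1 - t) * f a + t * f y := by
    have h := hf.2 (Set.mem_univ a) (Set.mem_univ y) (sub_nonneg.mpr ht1.le) ht0.le
      (sub_add_cancel 1 t)
    have heq : (1 - t) • a + t • y = a + t • (y - a) := by module
    rwa [heq] at h
  rw [add_sub_cancel_left, mulVec_smul, smul_dotProduct, dotProduct_smul, ← hQ]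
  simp only [smul_eq_mul]
  nlinarith [mul_lt_mul_of_pos_left htq ht0]

/-- Lemma 4.3: finite termination of the inner loop of SVANO-Bundle-Step. -/
theorem bundle_inner_loop_terminates (n : ℕ) (hn : 1 ≤ n)
    (f : (Fin n → ℝ) → ℝ) (hf : ConvexOn ℝ Set.univ f)
    (H : Matrix (Fin n) (Fin n) ℝ) (hH : H.PosDef)
    (α : ℝ) (hα : α ∈ Set.Ioo (0:ℝ) 1)
    (X : Set (Fin n → ℝ)) (hXne : X.Nonempty) (hXcpt : IsCompact X) (hXcvx : Convex ℝ X)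
    (xk : Fin n → ℝ) (hxk : xk ∈ interior X)
    (hnotmin : ¬ ∀ y : Fin n → ℝ, f xk ≤ f y)
    (x : ℕ → Fin n → ℝ) (hx1 : x 1 = xk) (hxX : ∀ m, 1 ≤ m → x m ∈ X)
    (g : ℕ → Fin n → ℝ)
    (hsub : ∀ m, 1 ≤ m → ∀ y : Fin n → ℝ, f y ≥ f (x m) + g m ⬝ᵥ (y - x m))
    (l : ℕ → (Fin n → ℝ) → ℝ)
    (hl : ∀ m, ∀ hm : 1 ≤ m, ∀ z : Fin n → ℝ,
      l m z = (Finset.Icc 1 m).sup'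
        (by rw [Finset.nonempty_Icc]; exact hm)
        (fun j => f (x j) + g j ⬝ᵥ (z - x j)))
    (hmin : ∀ m, 1 ≤ m → ∀ z ∈ X,
      l m (x (m+1)) + (1/2) * ((x (m+1) - xk) ⬝ᵥ H.mulVec (x (m+1) - xk)) ≤
      l m z + (1/2) * ((z - xk) ⬝ᵥ H.mulVec (z - xk))) :
    ∃ m : ℕ, 1 ≤ m ∧ f xk - f (x (m+1)) ≥ α * (f xk - l m (x (m+1))) := by
  by_contra! hcon
  obtain ⟨y, hy⟩ := not_forall.mp hnotmin
  obtain ⟨z, hzX, hz⟩ := exists_add_quadratic_lt hf H hxk (not_le.mp hy)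
  set δ := f xk - (f z + (1/2) * ((z - xk) ⬝ᵥ H.mulVec (z - xk))) with hδ
  have hδ0 : 0 < δ := sub_pos.mpr hz
  have hdecrease : ∀ m, 1 ≤ m → δ ≤ f xk - l m (x (m + 1)) := by
    intro m hm
    have hle : l m z ≤ f z := by
      rw [hl m hm]
      exact Finset.sup'_le _ _ fun j hj => hsub j (Finset.mem_Icc.mp hj).1 z
    have hnonneg := hH.posSemidef.dotProduct_mulVec_nonneg (x (m + 1) - xk)
    rw [star_trivial] at hnonneg
    linarith [hmin m hm z hzX]
  have hcont : Continuous f := continuousOn_univ.mp (hf.continuousOn isOpen_univ)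
  obtain ⟨i, j, hij, hsecond⟩ := exists_second_difference_le hcont hXcpt
    (fun m => hxX (m + 1) m.succ_pos) (mul_pos (sub_pos.mpr hα.2) hδ0)
  have hj : 1 ≤ j := by omega
  have hcut : f (x (i + 1)) + g (i + 1) ⬝ᵥ (x (j + 1) - x (i + 1)) ≤ l j (x (j + 1)) := by
    rw [hl j hj]
    exact Finset.le_sup' (fun k => f (x k) + g k ⬝ᵥ (x (j + 1) - x k))
      (Finset.mem_Icc.mpr ⟨by omega, hij⟩)
  have herr := linearization_error_le_second_difference (hsub (i + 1) i.succ_pos) (x (j + 1))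
  nlinarith [hcon j hj, mul_le_mul_of_nonneg_left (hdecrease j hj) (sub_pos.mpr hα.2).le]
end
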